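/- (Bound on the integral of the Hamiltonian along a periodic solution, proved inside Theorem 4.) Let H : ℝ^p × ℝ^{n+np} → ℝ be measurable in t for each u, continuously differentiable and convex in u for each t ∈ T_0, and suppose H(t,0) ≤ γ for all t ∈ T_0, where γ ≥ 0. Then every continuously differentiable, multiple periodic (with period T) solution u = (x,q) of (δ⊗J) ∂u/∂t + ∇_u H(t, u(t)) = 0 satisfies ∫_{T_0} H(t, u(t)) dt ≤ γ T^1⋯T^p + (√p · max_i T^i / (2π)) ∫_{T_0} |∂u/∂t|^2 dt. -/

import Mathlib

open MeasureTheory Real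

/-- The period parallelepiped `T₀ = [0,T¹] × ⋯ × [0,Tᵖ] ⊆ ℝᵖ`. -/
def periodBox {p : ℕ} (T : Fin p → ℝ) : Set (Fin p → ℝ) :=
  Set.univ.pi fun i => Set.Icc 0 (T i)

/-- `u` is multiple periodic with period `T`. -/
def MultiPeriodic {p : ℕ} {E : Type*} (T : Fin p → ℝ) (u : (Fin p → ℝ) → E) : Prop :=
  ∀ (k : Fin p → ℤ) (t : Fin p → ℝ), u (fun i => t i + (k i : ℝ) * T i) = u t

/-- `max_i T^i`. -/
noncomputable def maxPeriod {p : ℕ} (hp : 0 < p) (T : Fin p → ℝ) : ℝ :=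
  Finset.univ.sup' ⟨⟨0, hp⟩, Finset.mem_univ _⟩ T

/-- The Euclidean norm of `w = (x,q) ∈ ℝ^{n+np}`. -/
noncomputable def euclNorm {p n : ℕ} (w : (Fin n → ℝ) × (Fin n → Fin p → ℝ)) : ℝ :=
  Real.sqrt ((∑ i, (w.1 i) ^ 2) + ∑ i, ∑ α, (w.2 i α) ^ 2)

/-- `u = (x,q)` solves the multi-time Hamilton system
`(δ⊗J) ∂u/∂t + ∇_u H(t,u(t)) = 0` at every `t` of the period box, i.e.
`Σ_α ∂q_i^α/∂t^α = −∂H/∂x^i` and `∂x^i/∂t^β = ∂H/∂q_i^β`. -/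
def IsHamiltonSolution {p n : ℕ} (T : Fin p → ℝ)
    (H : (Fin p → ℝ) → (Fin n → ℝ) × (Fin n → Fin p → ℝ) → ℝ)
    (x : (Fin p → ℝ) → (Fin n → ℝ)) (q : (Fin p → ℝ) → (Fin n → Fin p → ℝ)) : Prop :=
  ∀ t ∈ periodBox T,
    (∀ i, (∑ α, fderiv ℝ q t (Pi.single α 1) i α)
        = - fderiv ℝ (H t) (x t, q t) ((Pi.single i 1 : Fin n → ℝ), 0)) ∧
    (∀ i β, fderiv ℝ x t (Pi.single β 1) i
        = fderiv ℝ (H t) (x t, q t) ((0 : Fin n → ℝ), Pi.single i (Pi.single β 1)))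

/-- **Wirtinger's inequality** for a periodic function of mean zero. -/
lemma integral_sq_le_integral_deriv_sq {f f' : ℝ → ℝ} {T : ℝ} (hT : 0 < T)
    (hf : ∀ s, HasDerivAt f (f' s) s) (hf' : Continuous f') (hper : f T = f 0)
    (hmean : ∫ s in (0 : ℝ)..T, f s = 0) :
    ∫ s in (0 : ℝ)..T, f s ^ 2 ≤ (T / (2 * π)) ^ 2 * ∫ s in (0 : ℝ)..T, f' s ^ 2 := by
  have hfc : Continuous f := continuous_iff_continuousAt.2 fun s => (hf s).continuousAt
  have hasSum : ∀ g : ℝ → ℝ, Continuous g →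
      HasSum (fun n => ‖fourierCoeffOn hT (fun s => (g s : ℂ)) n‖ ^ 2)
        (T⁻¹ * ∫ s in (0 : ℝ)..T, g s ^ 2) := by
    intro g hg
    have hc : Continuous fun s => (g s : ℂ) := by fun_prop
    have hL2 : MemLp (fun s => (g s : ℂ)) 2 (volume.restrict (Set.Ioc 0 T)) :=
      (memLp_two_iff_integrable_sq_norm hc.aestronglyMeasurable).2
        ((hc.norm.pow 2).integrableOn_Ioc)
    simpa using hasSum_sq_fourierCoeffOn hT hL2
  have hcoeff : ∀ n, ‖fourierCoeffOn hT (fun s => (f s : ℂ)) n‖ ^ 2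
      ≤ (T / (2 * π)) ^ 2 * ‖fourierCoeffOn hT (fun s => (f' s : ℂ)) n‖ ^ 2 := by
    intro n
    rcases eq_or_ne n 0 with rfl | hn
    · have hzero : fourierCoeffOn hT (fun s => (f s : ℂ)) 0 = 0 := by
        simp [fourierCoeffOn_eq_integral, intervalIntegral.integral_ofReal, hmean]
      rw [hzero]
      simp only [norm_zero, ne_eq, OfNat.ofNat_ne_zero, not_false_eq_true, zero_pow]
      positivity
    · have hn1 : (1 : ℝ) ≤ |(n : ℝ)| := by
        exact_mod_cast Int.one_le_abs hn
      have hcont : Continuous fun s => (f' s : ℂ) := by fun_prop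
      rw [fourierCoeffOn_of_hasDerivAt hT hn (fun s _ => (hf s).ofReal_comp)
        (hcont.intervalIntegrable _ _), hper, ← mul_pow]
      gcongr
      have hnorm : ‖(1 / (-2 * π * Complex.I * n) : ℂ)‖ ≤ 1 / (2 * π) := by
        simp only [norm_div, norm_one, norm_mul, norm_neg, Complex.norm_ofNat,
          Complex.norm_real, Complex.norm_I, mul_one, Complex.norm_intCast,
          Real.norm_of_nonneg pi_pos.le]
        exact one_div_le_one_div_of_le (by positivity)
          (le_mul_of_one_le_right (by positivity) hn1)
      calc _ = ‖(1 / (-2 * π * Complex.I * n) : ℂ)‖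
            * (T * ‖fourierCoeffOn hT (fun s => (f' s : ℂ)) n‖) := by
            simp [abs_of_pos hT]
        _ ≤ 1 / (2 * π) * (T * ‖fourierCoeffOn hT (fun s => (f' s : ℂ)) n‖) := by gcongr
        _ = _ := by ring
  have hle := hasSum_le hcoeff (hasSum f hfc) ((hasSum f' hf').mul_left _)
  have hscaled := mul_le_mul_of_nonneg_left hle hT.le
  calc _ = T * (T⁻¹ * ∫ s in (0 : ℝ)..T, f s ^ 2) := by field_simp
    _ ≤ _ := hscaled
    _ = _ := by field_simp

/-- The **isoperimetric inequality** for closed plane curves, in energy form: the symplectic area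
of a loop is controlled by its energy. -/
lemma integral_energy_sub_area_nonneg {f f' g g' : ℝ → ℝ} {T : ℝ} (hT : 0 < T)
    (hf : ∀ s, HasDerivAt f (f' s) s) (hg : ∀ s, HasDerivAt g (g' s) s)
    (hf' : Continuous f') (hg' : Continuous g') (hfT : f T = f 0) (hgT : g T = g 0) :
    0 ≤ ∫ s in (0 : ℝ)..T,
      (T / (2 * π) * (f' s ^ 2 + g' s ^ 2) - (g s * f' s - f s * g' s)) := by
  have hfc : Continuous f := continuous_iff_continuousAt.2 fun s => (hf s).continuousAt
  have hgc : Continuous g := continuous_iff_continuousAt.2 fun s => (hg s).continuousAt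
  set m : ℝ := T⁻¹ * ∫ s in (0 : ℝ)..T, g s with hm
  have hmean : ∫ s in (0 : ℝ)..T, (g s - m) = 0 := by
    rw [intervalIntegral.integral_sub (hgc.intervalIntegrable _ _) (by simp)]
    simp only [intervalIntegral.integral_const, sub_zero, smul_eq_mul, hm]
    field_simp
    ring
  have hwirt := integral_sq_le_integral_deriv_sq hT (fun s => (hg s).sub_const m) hg'
    (by rw [hgT]) hmean
  have hexact : ∫ s in (0 : ℝ)..T, (f' s * g s + f s * g' s - 2 * m * f' s) = 0 := by
    rw [intervalIntegral.integral_eq_sub_of_hasDerivAt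
      (fun s _ => ((hf s).mul (hg s)).sub ((hf s).const_mul (2 * m)))
      (Continuous.intervalIntegrable (by fun_prop) _ _)]
    simp [hfT, hgT]
  have hpt : ∀ s, T / (2 * π) * g' s ^ 2 - 2 * π / T * (g s - m) ^ 2
        + (f' s * g s + f s * g' s - 2 * m * f' s)
      ≤ T / (2 * π) * (f' s ^ 2 + g' s ^ 2) - (g s * f' s - f s * g' s) := by
    intro s
    have hsq : 0 ≤ T / (2 * π) * (f' s - 2 * π / T * (g s - m)) ^ 2 := by positivity
    have hexp : T / (2 * π) * (f' s - 2 * π / T * (g s - m)) ^ 2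
        = T / (2 * π) * f' s ^ 2 - 2 * (g s - m) * f' s + 2 * π / T * (g s - m) ^ 2 := by
      field_simp
      ring
    linarith
  refine le_trans ?_ (intervalIntegral.integral_mono_on hT.le
    (Continuous.intervalIntegrable (by fun_prop) _ _)
    (Continuous.intervalIntegrable (by fun_prop) _ _) fun s _ => hpt s)
  rw [intervalIntegral.integral_add (Continuous.intervalIntegrable (by fun_prop) _ _)
      (Continuous.intervalIntegrable (by fun_prop) _ _),
    intervalIntegral.integral_sub (Continuous.intervalIntegrable (by fun_prop) _ _)
      (Continuous.intervalIntegrable (by fun_prop) _ _),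
    intervalIntegral.integral_const_mul, intervalIntegral.integral_const_mul, hexact]
  have hscaled := mul_le_mul_of_nonneg_left hwirt (by positivity : 0 ≤ 2 * π / T)
  have hcancel : 2 * π / T * ((T / (2 * π)) ^ 2 * ∫ s in (0 : ℝ)..T, g' s ^ 2)
      = T / (2 * π) * ∫ s in (0 : ℝ)..T, g' s ^ 2 := by
    field_simp
  linarith

/-- First-order characterisation of convexity. -/
lemma ConvexOn.add_fderiv_sub_le {E : Type*} [NormedAddCommGroup E] [NormedSpace ℝ E]
    {f : E → ℝ} (hf : ConvexOn ℝ Set.univ f) {w : E} (hd : DifferentiableAt ℝ f w) (v : E) :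
    f w + fderiv ℝ f w (v - w) ≤ f v := by
  have hline : ConvexOn ℝ Set.univ (f ∘ AffineMap.lineMap (k := ℝ) w v) := by
    simpa using hf.comp_affineMap (AffineMap.lineMap (k := ℝ) w v)
  have hderiv : HasDerivAt (f ∘ AffineMap.lineMap (k := ℝ) w v) (fderiv ℝ f w (v - w)) 0 := by
    refine HasFDerivAt.comp_hasDerivAt 0 ?_ AffineMap.hasDerivAt_lineMap
    simpa using hd.hasFDerivAt
  have hslope := hline.le_slope_of_hasDerivAt (Set.mem_univ 0) (Set.mem_univ 1) one_pos hderiv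
  simp only [slope_def_field, Function.comp_apply, AffineMap.lineMap_apply_one,
    AffineMap.lineMap_apply_zero, sub_zero, div_one] at hslope
  linarith

lemma isCompact_periodBox {p : ℕ} (T : Fin p → ℝ) : IsCompact (periodBox T) :=
  isCompact_univ_pi fun _ => isCompact_Icc

lemma measurableSet_periodBox {p : ℕ} (T : Fin p → ℝ) : MeasurableSet (periodBox T) :=
  (isCompact_periodBox T).measurableSet

lemma volume_real_periodBox {p : ℕ} {T : Fin p → ℝ} (hT : ∀ i, 0 < T i) :
    volume.real (periodBox T) = ∏ i, T i := by
  rw [periodBox, Measure.real, volume_pi_pi]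
  simp [ENNReal.toReal_prod, fun i => (hT i).le]

lemma Continuous.integrableOn_periodBox {p : ℕ} {F : (Fin p → ℝ) → ℝ} (hF : Continuous F)
    (T : Fin p → ℝ) : IntegrableOn F (periodBox T) :=
  hF.continuousOn.integrableOn_compact (isCompact_periodBox T)

/-- A continuous function whose integral over every segment in the `a`-th direction is nonnegative
has nonnegative integral over the period box. -/
lemma setIntegral_periodBox_nonneg {p : ℕ} {T : Fin p → ℝ} (hT : ∀ i, 0 < T i)
    {F : (Fin p → ℝ) → ℝ} (hF : Continuous F) (a : Fin p)
    (h : ∀ t, 0 ≤ ∫ s in (0 : ℝ)..T a, F (Function.update t a s)) :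
    0 ≤ ∫ t in periodBox T, F t := by
  obtain _ | m := p
  · exact a.elim0
  let e := MeasurableEquiv.piFinSuccAbove (fun _ : Fin (m + 1) => ℝ) a
  have he : MeasurePreserving e.symm :=
    (volume_preserving_piFinSuccAbove (fun _ : Fin (m + 1) => ℝ) a).symm _
  have happ : ∀ s y, e.symm (s, y) = Function.update (a.insertNth (0 : ℝ) y) a s := by
    intro s y
    rw [Fin.update_insertNth]
    rfl
  have hpre : e.symm ⁻¹' periodBox T
      = Set.Icc 0 (T a) ×ˢ periodBox (a.removeNth T) := by
    ext ⟨s, y⟩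
    change a.insertNth s y ∈ periodBox T ↔ _
    simp only [periodBox, Set.mem_univ_pi, Fin.forall_iff_succAbove a, Set.mem_prod,
      Fin.insertNth_apply_same, Fin.insertNth_apply_succAbove, Fin.removeNth]
  have hFe : Continuous fun z : ℝ × (Fin m → ℝ) => F (e.symm z) :=
    hF.comp
      (Continuous.finInsertNth (A := fun _ => ℝ) a continuous_fst continuous_snd)
  rw [← he.setIntegral_preimage_emb e.symm.measurableEmbedding, hpre, Measure.volume_eq_prod,
    ← setIntegral_prod_swap, setIntegral_prod]
  · refine setIntegral_nonneg (measurableSet_periodBox _) fun y _ => ?_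
    simp only [Prod.swap, happ]
    rw [integral_Icc_eq_integral_Ioc, ← intervalIntegral.integral_of_le (hT a).le]
    exact h _
  · exact (hFe.comp continuous_swap).continuousOn.integrableOn_compact
      ((isCompact_periodBox _).prod isCompact_Icc)

lemma MultiPeriodic.update_period {p : ℕ} {E : Type*} {T : Fin p → ℝ} {u : (Fin p → ℝ) → E}
    (hu : MultiPeriodic T u) (t : Fin p → ℝ) (a : Fin p) :
    u (Function.update t a (T a)) = u (Function.update t a 0) := by
  rw [← hu (Pi.single a 1) (Function.update t a 0)]
  congr 1
  ext i
  rcases eq_or_ne i a with rfl | hi <;> simp [*]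

/-- The isoperimetric inequality along the `a`-th coordinate, integrated over the period box. -/
lemma setIntegral_energy_sub_area_nonneg {p : ℕ} {T : Fin p → ℝ} (hT : ∀ i, 0 < T i)
    {f g : (Fin p → ℝ) → ℝ} (hf : ContDiff ℝ 1 f) (hg : ContDiff ℝ 1 g)
    (hfper : MultiPeriodic T f) (hgper : MultiPeriodic T g) (a : Fin p) :
    0 ≤ ∫ t in periodBox T,
      (T a / (2 * π) * (fderiv ℝ f t (Pi.single a 1) ^ 2 + fderiv ℝ g t (Pi.single a 1) ^ 2)
        - (g t * fderiv ℝ f t (Pi.single a 1) - f t * fderiv ℝ g t (Pi.single a 1))) := by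
  have hderiv : ∀ {v : (Fin p → ℝ) → ℝ}, ContDiff ℝ 1 v →
      Continuous fun t => fderiv ℝ v t (Pi.single a 1) := fun hv =>
    (hv.continuous_fderiv one_ne_zero).clm_apply continuous_const
  have hline : ∀ {v : (Fin p → ℝ) → ℝ}, ContDiff ℝ 1 v → ∀ (t : Fin p → ℝ) (s : ℝ),
      HasDerivAt (fun s => v (Function.update t a s))
        (fderiv ℝ v (Function.update t a s) (Pi.single a 1)) s := fun hv t s =>
    ((hv.differentiable one_ne_zero _).hasFDerivAt).comp_hasDerivAt s (hasDerivAt_update t a s)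
  have hupd : ∀ t : Fin p → ℝ, Continuous fun s : ℝ => Function.update t a s := fun t =>
    continuous_const.update a continuous_id
  have hfd := hderiv hf
  have hgd := hderiv hg
  have hfc := hf.continuous
  have hgc := hg.continuous
  refine setIntegral_periodBox_nonneg hT (by fun_prop) a fun t => ?_
  exact integral_energy_sub_area_nonneg (hT a) (hline hf t) (hline hg t)
    (hfd.comp (hupd t)) (hgd.comp (hupd t)) (hfper.update_period t a) (hgper.update_period t a)

lemma apply_eq_sum_single {p n : ℕ} (L : (Fin n → ℝ) × (Fin n → Fin p → ℝ) →L[ℝ] ℝ)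
    (x : Fin n → ℝ) (q : Fin n → Fin p → ℝ) :
    L (x, q) = (∑ i, x i * L (Pi.single i 1, 0))
      + ∑ i, ∑ a, q i a * L (0, Pi.single i (Pi.single a 1)) := by
  have hx : x = ∑ i, x i • (Pi.single i 1 : Fin n → ℝ) := by
    simpa using pi_eq_sum_univ' x
  have hq : q = ∑ i, ∑ a, q i a • (Pi.single i (Pi.single a 1) : Fin n → Fin p → ℝ) := by
    ext i a
    simp [Finset.sum_apply, Pi.single_apply, ite_apply, apply_ite]
  have hsplit : L (x, q) = L.comp (ContinuousLinearMap.inl ℝ _ _) x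
      + L.comp (ContinuousLinearMap.inr ℝ _ _) q := by
    simp [← map_add]
  rw [hsplit]
  conv_lhs => rw [hx, hq]
  simp only [map_sum, map_smul, smul_eq_mul]
  rfl

lemma fderiv_coord {E ι : Type*} [NormedAddCommGroup E] [NormedSpace ℝ E] [Fintype ι]
    {F : ι → Type*} [∀ i, NormedAddCommGroup (F i)] [∀ i, NormedSpace ℝ (F i)]
    {u : E → ∀ i, F i} {t : E} (hu : DifferentiableAt ℝ u t) (i : ι) (v : E) :
    fderiv ℝ (fun t => u t i) t v = fderiv ℝ u t v i := by
  rw [((hasFDerivAt_pi'.1 hu.hasFDerivAt) i).fderiv]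
  rfl

lemma MultiPeriodic.coord {p : ℕ} {ι : Type*} {F : ι → Type*} {T : Fin p → ℝ}
    {u : (Fin p → ℝ) → ∀ i, F i} (hu : MultiPeriodic T u) (i : ι) :
    MultiPeriodic T fun t => u t i :=
  fun k t => congrFun (hu k t) i

/-- The Hamiltonian along a solution is bounded by its value at the origin plus the sum of the
symplectic area densities. -/
lemma IsHamiltonSolution.hamiltonian_le {p n : ℕ} {T : Fin p → ℝ}
    {H : (Fin p → ℝ) → (Fin n → ℝ) × (Fin n → Fin p → ℝ) → ℝ}
    {x : (Fin p → ℝ) → (Fin n → ℝ)} {q : (Fin p → ℝ) → (Fin n → Fin p → ℝ)}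
    (hsol : IsHamiltonSolution T H x q) {t : Fin p → ℝ} (ht : t ∈ periodBox T)
    (hdiff : Differentiable ℝ (H t)) (hconv : ConvexOn ℝ Set.univ (H t)) :
    H t (x t, q t) ≤ H t (0, 0) + ∑ i, ∑ a,
      (q t i a * fderiv ℝ x t (Pi.single a 1) i - x t i * fderiv ℝ q t (Pi.single a 1) i a) := by
  have hgrad := hconv.add_fderiv_sub_le (hdiff (x t, q t)) (0, 0)
  have hneg : ((0, 0) : (Fin n → ℝ) × (Fin n → Fin p → ℝ)) - (x t, q t) = -(x t, q t) :=
    zero_sub _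
  have hdx : ∀ i, fderiv ℝ (H t) (x t, q t) (Pi.single i 1, 0)
      = -∑ a, fderiv ℝ q t (Pi.single a 1) i a := fun i => by rw [(hsol t ht).1 i, neg_neg]
  rw [hneg, map_neg, apply_eq_sum_single] at hgrad
  simp only [hdx, ← (hsol t ht).2, mul_neg, Finset.mul_sum, Finset.sum_neg_distrib] at hgrad
  simp only [Finset.sum_sub_distrib]
  linarith

lemma le_sqrt_mul_maxPeriod {p : ℕ} (hp : 0 < p) {T : Fin p → ℝ} (hT : ∀ i, 0 < T i)
    (a : Fin p) : T a ≤ √p * maxPeriod hp T := by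
  have hmax : T a ≤ maxPeriod hp T := Finset.le_sup' T (Finset.mem_univ a)
  have hsqrt : 1 ≤ √(p : ℝ) := Real.one_le_sqrt.2 (by exact_mod_cast hp)
  exact hmax.trans (le_mul_of_one_le_left ((hT a).le.trans hmax) hsqrt)

/-- The integrated symplectic area of a periodic map is controlled by its Dirichlet energy. -/
lemma setIntegral_area_le_energy {p n : ℕ} (hp : 0 < p) {T : Fin p → ℝ} (hT : ∀ i, 0 < T i)
    {x : (Fin p → ℝ) → (Fin n → ℝ)} {q : (Fin p → ℝ) → (Fin n → Fin p → ℝ)}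
    (hx : ContDiff ℝ 1 x) (hq : ContDiff ℝ 1 q)
    (hxper : MultiPeriodic T x) (hqper : MultiPeriodic T q) :
    (∫ t in periodBox T, ∑ i, ∑ a,
      (q t i a * fderiv ℝ x t (Pi.single a 1) i - x t i * fderiv ℝ q t (Pi.single a 1) i a))
      ≤ (√p * maxPeriod hp T / (2 * π)) *
        ∫ t in periodBox T,
          ((∑ i, ∑ a, (fderiv ℝ x t (Pi.single a 1) i) ^ 2)
            + ∑ i, ∑ a, ∑ b, (fderiv ℝ q t (Pi.single b 1) i a) ^ 2) := by
  set C := √p * maxPeriod hp T / (2 * π) with hC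
  have hxc := hx.continuous
  have hqc := hq.continuous
  have hdx : ∀ a : Fin p, Continuous fun t => fderiv ℝ x t (Pi.single a 1) := fun a =>
    (hx.continuous_fderiv one_ne_zero).clm_apply continuous_const
  have hdq : ∀ a : Fin p, Continuous fun t => fderiv ℝ q t (Pi.single a 1) := fun a =>
    (hq.continuous_fderiv one_ne_zero).clm_apply continuous_const
  have hCa : ∀ a, T a / (2 * π) ≤ C := fun a => by
    rw [hC]
    gcongr
    exact le_sqrt_mul_maxPeriod hp hT a
  have hcoord : ∀ i a, 0 ≤ ∫ t in periodBox T,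
      (T a / (2 * π) * ((fderiv ℝ x t (Pi.single a 1) i) ^ 2
          + (fderiv ℝ q t (Pi.single a 1) i a) ^ 2)
        - (q t i a * fderiv ℝ x t (Pi.single a 1) i
          - x t i * fderiv ℝ q t (Pi.single a 1) i a)) := by
    intro i a
    have hqi : ContDiff ℝ 1 fun t => q t i := contDiff_pi.1 hq i
    have key := setIntegral_energy_sub_area_nonneg hT (contDiff_pi.1 hx i) (contDiff_pi.1 hqi a)
      (hxper.coord i) ((hqper.coord i).coord a) a
    simpa only [fderiv_coord (hqi.differentiable one_ne_zero _),
      fderiv_coord (hx.differentiable one_ne_zero _),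
      fderiv_coord (hq.differentiable one_ne_zero _)] using key
  have hsum : 0 ≤ ∫ t in periodBox T, ∑ i, ∑ a,
      (T a / (2 * π) * ((fderiv ℝ x t (Pi.single a 1) i) ^ 2
          + (fderiv ℝ q t (Pi.single a 1) i a) ^ 2)
        - (q t i a * fderiv ℝ x t (Pi.single a 1) i
          - x t i * fderiv ℝ q t (Pi.single a 1) i a)) := by
    rw [integral_finsetSum _ fun i _ => Continuous.integrableOn_periodBox (by fun_prop) T]
    refine Finset.sum_nonneg fun i _ => ?_
    rw [integral_finsetSum _ fun a _ => Continuous.integrableOn_periodBox (by fun_prop) T]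
    exact Finset.sum_nonneg fun a _ => hcoord i a
  rw [← sub_nonneg, ← integral_const_mul, ← integral_sub
    (Continuous.integrableOn_periodBox (by fun_prop) T)
    (Continuous.integrableOn_periodBox (by fun_prop) T)]
  refine hsum.trans (integral_mono (Continuous.integrableOn_periodBox (by fun_prop) T)
    (Continuous.integrableOn_periodBox (by fun_prop) T) fun t => ?_)
  simp only [Finset.sum_sub_distrib, mul_add, Finset.mul_sum, Finset.sum_add_distrib]
  gcongr with i _ a _ i _ a _
  · exact hCa a
  · refine le_trans (mul_le_mul_of_nonneg_right (hCa a) (sq_nonneg _))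
      (Finset.single_le_sum (f := fun b => C * (fderiv ℝ q t (Pi.single b 1) i a) ^ 2)
        (fun b _ => mul_nonneg ?_ (sq_nonneg _)) (Finset.mem_univ a))
    exact (div_nonneg (hT a).le (by positivity)).trans (hCa a)

/-- bound on the integral of the Hamiltonian along a periodic solution:
if `H(t,0) ≤ γ` on the period box, then every `C¹` multiply periodic solution satisfies
`∫ H(t,u(t)) ≤ γ T¹⋯Tᵖ + (√p · max_i Tⁱ/(2π)) ∫ |∂u/∂t|²`. -/
theorem hamilton_integral_bound
    (p n : ℕ) (hp : 0 < p) (hn : 0 < n)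
    (T : Fin p → ℝ) (hT : ∀ i, 0 < T i)
    (H : (Fin p → ℝ) → (Fin n → ℝ) × (Fin n → Fin p → ℝ) → ℝ)
    (hmeas : ∀ w, Measurable fun t => H t w)
    (hC1 : ∀ t ∈ periodBox T, ContDiff ℝ 1 (H t))
    (hconv : ∀ t ∈ periodBox T, ConvexOn ℝ Set.univ (H t))
    (γ : ℝ) (hγ : 0 ≤ γ)
    (hH0 : ∀ t ∈ periodBox T, H t (0, 0) ≤ γ)
    (x : (Fin p → ℝ) → (Fin n → ℝ)) (q : (Fin p → ℝ) → (Fin n → Fin p → ℝ))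
    (hx : ContDiff ℝ 1 x) (hq : ContDiff ℝ 1 q)
    (hxper : MultiPeriodic T x) (hqper : MultiPeriodic T q)
    (hsol : IsHamiltonSolution T H x q) :
    (∫ t in periodBox T, H t (x t, q t))
      ≤ γ * (∏ i, T i)
        + (Real.sqrt p * maxPeriod hp T / (2 * π)) *
          ∫ t in periodBox T,
            ((∑ i, ∑ a, (fderiv ℝ x t (Pi.single a 1) i) ^ 2)
              + ∑ i, ∑ a, ∑ b, (fderiv ℝ q t (Pi.single b 1) i a) ^ 2) := by
  have harea := setIntegral_area_le_energy hp hT hx hq hxper hqper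
  have hpt : ∀ t ∈ periodBox T, H t (x t, q t) ≤ γ + ∑ i, ∑ a,
      (q t i a * fderiv ℝ x t (Pi.single a 1) i - x t i * fderiv ℝ q t (Pi.single a 1) i a) :=
    fun t ht => (hsol.hamiltonian_le ht ((hC1 t ht).differentiable one_ne_zero) (hconv t ht)).trans
      (add_le_add_left (hH0 t ht) _)
  by_cases hint : IntegrableOn (fun t => H t (x t, q t)) (periodBox T)
  · have hxc := hx.continuous
    have hqc := hq.continuous
    have hdx : ∀ a : Fin p, Continuous fun t => fderiv ℝ x t (Pi.single a 1) := fun a =>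
      (hx.continuous_fderiv one_ne_zero).clm_apply continuous_const
    have hdq : ∀ a : Fin p, Continuous fun t => fderiv ℝ q t (Pi.single a 1) := fun a =>
      (hq.continuous_fderiv one_ne_zero).clm_apply continuous_const
    refine (setIntegral_mono_on hint (Continuous.integrableOn_periodBox (by fun_prop) T)
      (measurableSet_periodBox T) hpt).trans ?_
    rw [integral_add (continuous_const.integrableOn_periodBox T)
      (Continuous.integrableOn_periodBox (by fun_prop) T), setIntegral_const,
      volume_real_periodBox hT, smul_eq_mul, mul_comm]
    gcongr
  · have hmax : 0 ≤ √(p : ℝ) * maxPeriod hp T :=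
      (hT ⟨0, hp⟩).le.trans (le_sqrt_mul_maxPeriod hp hT ⟨0, hp⟩)
    have hprod : 0 ≤ ∏ i, T i := Finset.prod_nonneg fun i _ => (hT i).le
    rw [integral_undef hint]
    refine add_nonneg (mul_nonneg hγ hprod) (mul_nonneg (by positivity) ?_)
    exact integral_nonneg fun t => by positivity
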